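/- n-point Nevanlinna–Pick interpolation with real nodes: let n ≥ 3, let r₁, …, rₙ ∈ (−1,1) ⊂ ℝ be pairwise distinct and let s₁, …, sₙ ∈ 𝔹. Define Q₀^m := s_m for m = 1, …, n, and recursively Q_κ^ℓ := M_{r_κ}(r_ℓ)⁻¹·M_{Q_{κ−1}^κ}(Q_{κ−1}^ℓ) for 1 ≤ κ ≤ n−1 and κ < ℓ ≤ n (interpreting the quaternionic inverses as the total inverse, which is all that is needed since the stated conditions guarantee that all relevant terms lie in 𝔹). Then the interpolation problem f(r_m) = s_m for m = 1, …, n, with f a slice regular self-map of 𝔹, has infinitely many solutions if and only if for every κ with 1 ≤ κ ≤ n−1 and every ℓ with κ < ℓ ≤ n one has |Q_{κ−1}^κ| < 1, |Q_{κ−1}^ℓ| < 1 and ρ(Q_{κ−1}^κ, Q_{κ−1}^ℓ) < ρ(r_κ, r_ℓ). -/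

import Mathlib

noncomputable section

abbrev H : Type := Quaternion ℝ

namespace QPaper

/-- The complex slice determined by `I`: the real span of `1` and `I`. -/
def sliceSet (I : H) : Set H := {q | ∃ x y : ℝ, q = (x : H) + y • I}

/-- Evaluation of the power series `q ↦ ∑ qᵐ aₘ` with right coefficients. -/
def evalC (a : ℕ → H) (q : H) : H := ∑' m, q ^ m * a m

/-- The series with coefficients `a` converges at every point of the unit ball. -/
def SummableOn (a : ℕ → H) : Prop := ∀ q : H, ‖q‖ < 1 → Summable fun m => q ^ m * a m

/-- `a` are the coefficients of a slice regular self-map of the unit ball. -/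
def SelfMap (a : ℕ → H) : Prop :=
  SummableOn a ∧ ∀ q : H, ‖q‖ < 1 → ‖evalC a q‖ < 1

/-- Coefficients of the ∗-product. -/
def starMulC (a b : ℕ → H) : ℕ → H := fun m => ∑ ℓ ∈ Finset.range (m + 1), a (m - ℓ) * b ℓ

/-- Coefficients of the ∗-inverse (of a series with invertible constant term). -/
def starInvC (a : ℕ → H) : ℕ → H
  | 0 => (a 0)⁻¹
  | m + 1 => -(a 0)⁻¹ * ∑ ℓ : Fin (m + 1), a (m + 1 - ℓ.val) * starInvC a ℓ.val
  decreasing_by exact ℓ.isLt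

/-- Coefficients of `1 - q p̄`. -/
def oneMinusQPbarC (p : H) : ℕ → H := fun m => if m = 0 then 1 else if m = 1 then -(star p) else 0

/-- Coefficients of `q - p`. -/
def qMinusPC (p : H) : ℕ → H := fun m => if m = 0 then -p else if m = 1 then 1 else 0

/-- Coefficients of the regular Möbius transformation `ℳ_p = (1 - q p̄)^{-∗} ∗ (q - p)`. -/
def mobiusC (p : H) : ℕ → H := starMulC (starInvC (oneMinusQPbarC p)) (qMinusPC p)

/-- Coefficients of `ℳ_{t₁} ∗ ⋯ ∗ ℳ_{t_κ}`. -/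
def blaschkeListC : List H → (ℕ → H)
  | [] => fun m => if m = 0 then 1 else 0
  | t :: ts => starMulC (mobiusC t) (blaschkeListC ts)

/-- `a` are the coefficients of a regular Blaschke product of degree `κ`,
i.e. of `ℳ_{t₁} ∗ ⋯ ∗ ℳ_{t_κ} u` with the `tᵢ` in `𝔹` and `u` unimodular. -/
def IsBlaschke (a : ℕ → H) (κ : ℕ) : Prop :=
  ∃ (ts : List H) (u : H), ts.length = κ ∧ (∀ t ∈ ts, ‖t‖ < 1) ∧ ‖u‖ = 1 ∧
    a = fun m => blaschkeListC ts m * u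

/-- Coefficients of `ℳ_w ∙ f = (1 - f w̄)^{-∗} ∗ (f - w)`. -/
def bulletC (w : H) (a : ℕ → H) : ℕ → H :=
  starMulC (starInvC (fun m => (if m = 0 then (1 : H) else 0) - a m * star w))
    (fun m => a m - if m = 0 then w else 0)

/-- Coefficients of the regular difference quotient `ℛ_{f,p}`,
the unique slice regular function with `f(q) = f(p) + (q - p) ∗ ℛ_{f,p}(q)`. -/
def diffQuotC (a : ℕ → H) (p : H) : ℕ → H := fun m => ∑' k, p ^ k * a (k + m + 1)

/-- Coefficients of the hyperbolic difference quotient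
`f⋆_p = (1 - q p̄) ∗ ℛ_{f,p} ∗ (1 - \overline{f(p)} f)^{-∗} = ℳ_p^{-∗} ∗ (ℳ_{f(p)} ∙ f)`. -/
def hdqC (a : ℕ → H) (p : H) : ℕ → H :=
  starMulC (starMulC (oneMinusQPbarC p) (diffQuotC a p))
    (starInvC (fun m => (if m = 0 then (1 : H) else 0) - star (evalC a p) * a m))

/-- Iterated hyperbolic difference quotients: `ihdqC a [p₁, …, pₙ] = ((f⋆_{p₁})⋆_{p₂} ⋯)⋆_{pₙ}`. -/
def ihdqC (a : ℕ → H) : List H → (ℕ → H)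
  | [] => a
  | p :: ps => ihdqC (hdqC a p) ps

/-- `𝒯_p(q) = (1 - q p)⁻¹ q (1 - q p)`. -/
def mobiusT (p q : H) : H := (1 - q * p)⁻¹ * q * (1 - q * p)

/-- `M_p(q) = (1 - q p̄)⁻¹ (q - p)`. -/
def mobiusM (p q : H) : H := (1 - q * star p)⁻¹ * (q - p)

/-- Pointwise evaluation of the regular Möbius transformation: `ℳ_p(q) = M_p(𝒯_p(q))`. -/
def mobiusEval (p q : H) : H := mobiusM p (mobiusT p q)

/-- The pseudo-hyperbolic distance `ρ(p,q) = |M_p(q)|`. -/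
def rho (p q : H) : ℝ := ‖mobiusM p q‖

/-- The Poincaré distance `δ(p,q) = tanh⁻¹ ρ(p,q) = ½ log((1+ρ)/(1−ρ))`. -/
def pdist (p q : H) : ℝ := (1/2 : ℝ) * Real.log ((1 + rho p q) / (1 - rho p q))


/-- The data `Q_κ^ℓ` of the Nevanlinna–Pick algorithm with real nodes:
`Q₀^ℓ = s_ℓ` and `Q_κ^ℓ = M_{r_κ}(r_ℓ)⁻¹ · M_{Q_{κ−1}^κ}(Q_{κ−1}^ℓ)`. -/
def npQ (r : ℕ → ℝ) (s : ℕ → H) : ℕ → ℕ → H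
  | 0, ℓ => s ℓ
  | κ + 1, ℓ =>
      ((1 - ((r ℓ : ℝ) : H) * ((r (κ + 1) : ℝ) : H))⁻¹ *
          (((r ℓ : ℝ) : H) - ((r (κ + 1) : ℝ) : H)))⁻¹ *
        ((1 - npQ r s κ ℓ * star (npQ r s κ (κ + 1)))⁻¹ *
          (npQ r s κ ℓ - npQ r s κ (κ + 1)))

/-- The quaternions as a left complex vector space. -/
def HC : Type := H
instance : NormedAddCommGroup HC := inferInstanceAs (NormedAddCommGroup H)
instance : CompleteSpace HC := inferInstanceAs (CompleteSpace H)
def toHC (q : H) : HC := q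
def ofHC (q : HC) : H := q

theorem norm_coeComplex' (z : ℂ) : ‖(z : H)‖ = ‖z‖ := by
  have h : ‖(z : H)‖ ^ 2 = ‖z‖ ^ 2 := by
    rw [sq, ← Quaternion.normSq_eq_norm_mul_self, Quaternion.normSq_def', ← Complex.normSq_eq_norm_sq,
      Complex.normSq_apply]
    simp; ring
  exact (pow_left_inj₀ (norm_nonneg _) (norm_nonneg _) two_ne_zero).1 h

theorem coeComplex_pow' (z : ℂ) (n : ℕ) : ((z ^ n : ℂ) : H) = (z : H) ^ n :=
  map_pow Quaternion.ofComplex z n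

instance : Module ℂ HC where
  smul z q := toHC ((z : H) * ofHC q)
  one_smul q := by
    change ((1 : ℂ) : H) * (ofHC q : H) = ofHC q
    simp
  mul_smul z w q := by
    change ((z * w : ℂ) : H) * (ofHC q : H) = (z : H) * ((w : H) * ofHC q)
    rw [Quaternion.coeComplex_mul, mul_assoc]
  smul_zero z := mul_zero (z : H)
  smul_add z a b := mul_add (z : H) (ofHC a) (ofHC b)
  add_smul z w q := by
    change ((z + w : ℂ) : H) * (ofHC q : H) = (z : H) * ofHC q + (w : H) * ofHC q
    rw [Quaternion.coeComplex_add, add_mul]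
  zero_smul q := by
    change ((0 : ℂ) : H) * (ofHC q : H) = 0
    simp

instance : NormedSpace ℂ HC where
  norm_smul_le z q := by
    change ‖(z : H) * ofHC q‖ ≤ ‖z‖ * ‖(ofHC q : H)‖
    rw [norm_mul, norm_coeComplex']

instance : StrictConvexSpace ℝ HC :=
  StrictConvexSpace.of_norm_add_ne_two fun x y hx hy hne h => by
    have := (sameRay_iff_norm_add (x := (ofHC x : H)) (y := ofHC y)).2
      (by change ‖x + y‖ = ‖x‖ + ‖y‖; rw [h, hx, hy]; norm_num)
    exact hne (this.eq_of_norm_eq (hx.trans hy.symm))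

/-- The restriction to the complex slice. -/
def FC (a : ℕ → H) (z : ℂ) : HC := toHC (evalC a (z : H))

theorem norm_FC (a : ℕ → H) (z : ℂ) : ‖FC a z‖ = ‖evalC a (z : H)‖ := rfl

theorem SummableOn.norm {a : ℕ → H} (ha : SummableOn a) {t : ℝ} (h0 : 0 ≤ t) (ht : t < 1) :
    Summable fun m => t ^ m * ‖a m‖ := by
  have := (ha (t : H) (by rw [Quaternion.norm_coe, Real.norm_of_nonneg h0]; exact ht)).norm
  refine this.congr fun m => ?_
  rw [norm_mul, norm_pow, Quaternion.norm_coe, Real.norm_of_nonneg h0]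

theorem SummableOn.norm' {a : ℕ → H} (ha : SummableOn a) {q : H} (hq : ‖q‖ < 1) :
    Summable fun m => ‖q ^ m * a m‖ := (ha q hq).norm

theorem summableOn_of_bdd {a : ℕ → H} {C : ℝ} (h : ∀ m, ‖a m‖ ≤ C) : SummableOn a := by
  intro q hq
  refine Summable.of_norm_bounded (g := fun m => ‖q‖ ^ m * C) ?_ ?_
  · exact (summable_geometric_of_lt_one (norm_nonneg _) hq).mul_right C
  · intro m
    rw [norm_mul, norm_pow]
    exact mul_le_mul_of_nonneg_left (h m) (by positivity)

/-- the formal multilinear series of the slice restriction -/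
def pC (a : ℕ → H) : FormalMultilinearSeries ℂ ℂ HC :=
  fun n => ContinuousMultilinearMap.mkPiRing ℂ (Fin n) (toHC (a n))

theorem hasFPS {a : ℕ → H} (ha : SummableOn a) : HasFPowerSeriesOnBall (FC a) (pC a) 0 1 where
  r_le := by
    refine ENNReal.le_of_forall_nnreal_lt fun t ht => ?_
    refine (pC a).le_radius_of_summable ?_
    have ht' : (t : ℝ) < 1 := by exact_mod_cast ht
    refine (ha.norm t.coe_nonneg ht').congr fun m => ?_
    rw [pC, ContinuousMultilinearMap.norm_mkPiRing, mul_comm]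
    rfl
  r_pos := one_pos
  hasSum := by
    intro z hz
    have hz' : ‖z‖ < 1 := by
      rw [show (1 : ENNReal) = ENNReal.ofReal 1 by simp, Metric.eball_ofReal] at hz
      simpa using hz
    have := (ha (z : H) (by rwa [norm_coeComplex'])).hasSum
    rw [zero_add]
    have e : (fun n => pC a n fun _ => z) = fun m => toHC ((z : H) ^ m * a m) := by
      funext m
      simp only [pC, ContinuousMultilinearMap.mkPiRing_apply, Finset.prod_const, Finset.card_univ,
        Fintype.card_fin]
      change ((z ^ m : ℂ) : H) * a m = _
      rw [coeComplex_pow']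
      rfl
    rw [e]
    exact this

theorem FC_diff {a : ℕ → H} (ha : SummableOn a) : DifferentiableOn ℂ (FC a) (Metric.ball 0 1) := by
  have := (hasFPS ha).differentiableOn
  rwa [show (1 : ENNReal) = ENNReal.ofReal 1 by simp, Metric.eball_ofReal] at this

theorem FC_dcc {a : ℕ → H} (ha : SummableOn a) {t : ℝ} (ht : t < 1) :
    DiffContOnCl ℂ (FC a) (Metric.ball 0 t) := by
  apply DifferentiableOn.diffContOnCl
  exact (FC_diff ha).mono (Metric.closure_ball_subset_closedBall.trans (Metric.closedBall_subset_ball ht))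

theorem max_weak {a : ℕ → H} (ha : SummableOn a) {t C : ℝ} (ht : t < 1)
    (hC : ∀ z : ℂ, ‖z‖ = t → ‖evalC a (z : H)‖ ≤ C) (z : ℂ) (hz : ‖z‖ ≤ t) :
    ‖evalC a (z : H)‖ ≤ C := by
  rcases hz.lt_or_eq with h | h
  · have ht0 : t ≠ 0 := ((norm_nonneg z).trans_lt h).ne'
    refine Complex.norm_le_of_forall_mem_frontier_norm_le Metric.isBounded_ball (FC_dcc ha ht) ?_
      (subset_closure (by simpa using h))
    intro w hw
    rw [frontier_ball _ ht0] at hw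
    exact hC w (by simpa using hw)
  · exact hC z h

theorem coeff_iter {a : ℕ → H} (ha : SummableOn a) (m : ℕ) :
    iteratedDeriv m (FC a) 0 = (m.factorial : ℂ) • toHC (a m) := by
  have := (hasFPS ha).factorial_smul 1 m
  rw [iteratedDeriv_eq_iteratedFDeriv, ← this, ← Nat.cast_smul_eq_nsmul ℂ]
  simp [pC]

theorem cauchy_bound {a : ℕ → H} (ha : SummableOn a) {C : ℝ}
    (hC : ∀ z : ℂ, ‖z‖ < 1 → ‖evalC a (z : H)‖ ≤ C) (m : ℕ) : ‖a m‖ ≤ C := by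
  have key : ∀ t : ℝ, 0 < t → t < 1 → ‖a m‖ * t ^ m ≤ C := by
    intro t h0 h1
    have := Complex.norm_iteratedDeriv_le_of_forall_mem_sphere_norm_le m h0 (FC_dcc ha h1)
      (C := C) (fun z hz => hC z (by
        have : ‖z‖ = t := by simpa using hz
        linarith))
    rw [coeff_iter ha, norm_smul, mul_div_assoc] at this
    have hf : (0 : ℝ) < m.factorial := by exact_mod_cast m.factorial_pos
    have h2 : ‖(m.factorial : ℂ)‖ = m.factorial := by simp
    rw [h2] at this
    have h3 : ‖a m‖ ≤ C / t ^ m := le_of_mul_le_mul_left this hf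
    rwa [le_div_iff₀ (by positivity)] at h3
  have hlim : Filter.Tendsto (fun t : ℝ => ‖a m‖ * t ^ m) (nhdsWithin 1 (Set.Iio 1)) (nhds (‖a m‖ * 1 ^ m)) :=
    ((continuous_const.mul (continuous_pow m)).tendsto 1).mono_left nhdsWithin_le_nhds
  rw [one_pow, mul_one] at hlim
  refine le_of_tendsto hlim ?_
  filter_upwards [Ioo_mem_nhdsLT (zero_lt_one (α := ℝ))] with t ht
  exact key t ht.1 ht.2

theorem max_strong {a : ℕ → H} (ha : SummableOn a) {C : ℝ}
    (hC : ∀ z : ℂ, ‖z‖ < 1 → ‖evalC a (z : H)‖ ≤ C) (z₀ : ℂ) (hz₀ : ‖z₀‖ < 1)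
    (h : ‖evalC a (z₀ : H)‖ = C) (m : ℕ) (hm : m ≠ 0) : a m = 0 := by
  have h1 := Complex.eqOn_of_isPreconnected_of_isMaxOn_norm (convex_ball (0 : ℂ) 1).isPreconnected
    Metric.isOpen_ball (FC_diff ha) (c := z₀) (by simpa using hz₀)
    (fun z hz => by
      change ‖evalC a (z : H)‖ ≤ ‖evalC a (z₀ : H)‖
      rw [h]; exact hC z (by simpa using hz))
  have h2 : FC a =ᶠ[nhds 0] fun _ => FC a z₀ := by
    filter_upwards [Metric.ball_mem_nhds (0 : ℂ) one_pos] with z hz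
    exact h1 hz
  have h3 := h2.iteratedDeriv_eq m
  rw [coeff_iter ha, iteratedDeriv_const, if_neg hm] at h3
  exact (smul_eq_zero.1 h3).resolve_left (by exact_mod_cast m.factorial_ne_zero)

theorem exists_rot_aux (q u : H) (hu : u ≠ 0) (z : ℂ) (h : q * u = u * (z : H)) :
    q = u * (z : H) * u⁻¹ := by
  rw [eq_mul_inv_iff_mul_eq₀ hu, h]

theorem conj_pow' (q u : H) (hu : u ≠ 0) (m : ℕ) : (u * q * u⁻¹) ^ m = u * q ^ m * u⁻¹ := by
  induction m with
  | zero => simp [hu]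
  | succ m ih =>
    rw [pow_succ, ih, pow_succ]
    simp only [mul_assoc, inv_mul_cancel_left₀ hu]

theorem exists_rot (q : H) : ∃ u : H, u ≠ 0 ∧ ∃ z : ℂ, q = u * (z : H) * u⁻¹ := by
  set y : ℝ := Real.sqrt (q.imI ^ 2 + q.imJ ^ 2 + q.imK ^ 2) with hy
  have hy2 : y ^ 2 = q.imI ^ 2 + q.imJ ^ 2 + q.imK ^ 2 := Real.sq_sqrt (by positivity)
  obtain ⟨u, u0, u1, u2, u3⟩ : ∃ u : H, u.re = 0 ∧ u.imI = q.imI + y ∧ u.imJ = q.imJ ∧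
      u.imK = q.imK := ⟨⟨0, q.imI + y, q.imJ, q.imK⟩, rfl, rfl, rfl, rfl⟩
  by_cases h : u = 0
  · obtain ⟨v, v0, v1, v2, v3⟩ : ∃ v : H, v.re = 0 ∧ v.imI = 0 ∧ v.imJ = 1 ∧ v.imK = 0 :=
      ⟨⟨0, 0, 1, 0⟩, rfl, rfl, rfl, rfl⟩
    have hv0 : v ≠ 0 := by
      rintro rfl
      exact zero_ne_one v2
    rw [h] at u1 u2 u3
    change 0 = q.imI + y at u1
    change 0 = q.imJ at u2
    change 0 = q.imK at u3
    refine ⟨v, hv0, ⟨q.re, y⟩, exists_rot_aux _ _ hv0 _ ?_⟩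
    ext <;> simp [v0, v1, v2, v3, ← u2, ← u3]
    linarith
  · refine ⟨u, h, ⟨q.re, y⟩, exists_rot_aux _ _ h _ ?_⟩
    ext <;> simp [u0, u1, u2, u3] <;> linarith

theorem evalC_rot (a : ℕ → H) {u : H} (hu : u ≠ 0) (z : H) :
    evalC a (u * z * u⁻¹) = u * evalC (fun m => u⁻¹ * a m) z := by
  unfold evalC
  rw [← tsum_mul_left]
  congr 1
  funext m
  rw [conj_pow' _ _ hu]
  simp only [mul_assoc]

theorem norm_rot {u : H} (hu : u ≠ 0) (z : H) : ‖u * z * u⁻¹‖ = ‖z‖ := by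
  rw [norm_mul, norm_mul, norm_inv]
  field_simp [norm_ne_zero_iff.2 hu]

theorem SummableOn.left {a : ℕ → H} (ha : SummableOn a) (u : H) :
    SummableOn (fun m => u * a m) := by
  intro q hq
  refine Summable.of_norm ?_
  refine ((ha.norm' hq).mul_left ‖u‖).congr fun m => ?_
  simp only [norm_mul]; ring

/-- `f` converges in the ball and is bounded by `C`. -/
def Bd (a : ℕ → H) (C : ℝ) : Prop := SummableOn a ∧ ∀ q : H, ‖q‖ < 1 → ‖evalC a q‖ ≤ C

theorem Bd.coeff_le {a : ℕ → H} {C : ℝ} (h : Bd a C) (m : ℕ) : ‖a m‖ ≤ C :=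
  cauchy_bound h.1 (fun z hz => h.2 z (by rwa [norm_coeComplex'])) m

theorem sphere_bound {a : ℕ → H} (ha : SummableOn a) {t C : ℝ} (ht : t < 1)
    (hC : ∀ q : H, ‖q‖ = t → ‖evalC a q‖ ≤ C) (q : H) (hq : ‖q‖ ≤ t) : ‖evalC a q‖ ≤ C := by
  obtain ⟨u, hu, z, rfl⟩ := exists_rot q
  rw [norm_rot hu, norm_coeComplex'] at hq
  have hu' : 0 < ‖u‖ := norm_pos_iff.2 hu
  have := max_weak (ha.left u⁻¹) ht (C := ‖u‖⁻¹ * C) (fun w hw => by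
    have := hC (u * (w : H) * u⁻¹) (by rw [norm_rot hu, norm_coeComplex', hw])
    rw [evalC_rot a hu, norm_mul] at this
    rwa [le_inv_mul_iff₀ hu']) z hq
  rw [evalC_rot a hu, norm_mul]
  rwa [le_inv_mul_iff₀ hu'] at this

theorem Bd.const {a : ℕ → H} {C : ℝ} (h : Bd a C) {q : H} (hq : ‖q‖ < 1) (he : ‖evalC a q‖ = C)
    (m : ℕ) (hm : m ≠ 0) : a m = 0 := by
  obtain ⟨u, hu, z, rfl⟩ := exists_rot q
  rw [norm_rot hu, norm_coeComplex'] at hq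
  have hu' : 0 < ‖u‖ := norm_pos_iff.2 hu
  have := max_strong (h.1.left u⁻¹) (C := ‖u‖⁻¹ * C) (fun w hw => by
    have := h.2 (u * (w : H) * u⁻¹) (by rwa [norm_rot hu, norm_coeComplex'])
    rw [evalC_rot a hu, norm_mul] at this
    rwa [le_inv_mul_iff₀ hu']) z hq (by
      rw [evalC_rot a hu, norm_mul] at he
      rw [← he]; field_simp) m hm
  exact (mul_eq_zero.1 this).resolve_left (inv_ne_zero hu)

theorem evalC_const {a : ℕ → H} (h : ∀ m, m ≠ 0 → a m = 0) (q : H) : evalC a q = a 0 := by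
  unfold evalC
  rw [tsum_eq_single 0 (fun m hm => by rw [h m hm, mul_zero])]
  simp

/-- coefficient sequence -/
def cf (φ : PowerSeries H) : ℕ → H := fun m => PowerSeries.coeff m φ

def ev (φ : PowerSeries H) (q : H) : H := evalC (cf φ) q

def Cv (φ : PowerSeries H) : Prop := SummableOn (cf φ)

theorem mul_fam {φ ψ : PowerSeries H} (hφ : Cv φ) (hψ : Cv ψ) {q : H} (hq : ‖q‖ < 1) :
    Summable fun p : ℕ × ℕ => ‖q ^ (p.1 + p.2) * (cf φ p.1 * cf ψ p.2)‖ := by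
  have h1 := hφ.norm (norm_nonneg q) hq
  have h2 := hψ.norm (norm_nonneg q) hq
  refine (h1.mul_of_nonneg h2 (fun _ => by positivity) (fun _ => by positivity)).congr fun p => ?_
  simp only [norm_mul, norm_pow, pow_add]; ring

theorem cf_mul (φ ψ : PowerSeries H) (q : H) (n : ℕ) : q ^ n * cf (φ * ψ) n =
    ∑ p ∈ Finset.HasAntidiagonal.antidiagonal n, q ^ (p.1 + p.2) * (cf φ p.1 * cf ψ p.2) := by
  rw [cf, PowerSeries.coeff_mul, Finset.mul_sum]
  refine Finset.sum_congr rfl fun p hp => ?_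
  rw [Finset.HasAntidiagonal.mem_antidiagonal.1 hp]; rfl

theorem Cv.mul {φ ψ : PowerSeries H} (hφ : Cv φ) (hψ : Cv ψ) : Cv (φ * ψ) := by
  intro q hq
  have := (Finset.HasAntidiagonal.sigmaAntidiagonalEquivProd (A := ℕ)).summable_iff.2 (mul_fam hφ hψ hq).of_norm
  refine (this.sigma' (fun n => (hasSum_fintype _).summable)).congr fun n => ?_
  rw [cf_mul, tsum_fintype, ← Finset.sum_coe_sort (Finset.HasAntidiagonal.antidiagonal n)]
  rfl

theorem ev_mul {φ ψ : PowerSeries H} (hφ : Cv φ) (hψ : Cv ψ) {q : H} (hq : ‖q‖ < 1) :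
    ev (φ * ψ) q = ∑' m, q ^ m * ev φ q * cf ψ m := by
  have hs := (mul_fam hφ hψ hq).of_norm
  have e1 : ev (φ * ψ) q = ∑' p : ℕ × ℕ, q ^ (p.1 + p.2) * (cf φ p.1 * cf ψ p.2) := by
    rw [← (Finset.HasAntidiagonal.sigmaAntidiagonalEquivProd (A := ℕ)).tsum_eq]
    have := (Finset.HasAntidiagonal.sigmaAntidiagonalEquivProd (A := ℕ)).summable_iff.2 hs
    refine Eq.trans ?_ (this.tsum_sigma' (fun n => (hasSum_fintype _).summable)).symm
    unfold ev evalC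
    congr 1
    funext n
    rw [cf_mul, tsum_fintype, ← Finset.sum_coe_sort]
    rfl
  rw [e1, ← (Equiv.prodComm ℕ ℕ).tsum_eq]
  have hs' := (Equiv.prodComm ℕ ℕ).summable_iff.2 hs
  refine Eq.trans hs'.tsum_prod ?_
  congr 1
  funext m
  have : (fun k => q ^ (k + m) * (cf φ k * cf ψ m)) = fun k => q ^ m * (q ^ k * cf φ k) * cf ψ m := by
    funext k
    rw [add_comm, pow_add]; simp only [mul_assoc]
  change ∑' k, q ^ (k + m) * (cf φ k * cf ψ m) = _
  rw [this, tsum_mul_right, tsum_mul_left]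
  rfl

theorem ev_mul_ne {φ ψ : PowerSeries H} (hφ : Cv φ) (hψ : Cv ψ) {q : H} (hq : ‖q‖ < 1)
    (h : ev φ q ≠ 0) : ev (φ * ψ) q = ev φ q * ev ψ ((ev φ q)⁻¹ * q * ev φ q) := by
  rw [ev_mul hφ hψ hq]
  unfold ev evalC
  rw [← tsum_mul_left]
  change (∑' m, q ^ m * ev φ q * cf ψ m) = ∑' m, ev φ q * (_ ^ m * cf ψ m)
  congr 1
  funext m
  have := conj_pow' q _ (inv_ne_zero h) m
  rw [inv_inv] at this
  change _ = ev φ q * (((ev φ q)⁻¹ * q * ev φ q) ^ m * cf ψ m)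
  rw [this, ← mul_assoc, ← mul_assoc, ← mul_assoc, mul_inv_cancel₀ h, one_mul]

theorem ev_mul_zero {φ ψ : PowerSeries H} (hφ : Cv φ) (hψ : Cv ψ) {q : H} (hq : ‖q‖ < 1)
    (h : ev φ q = 0) : ev (φ * ψ) q = 0 := by
  rw [ev_mul hφ hψ hq, h]; simp

theorem ev_mul_comm {φ ψ : PowerSeries H} (hφ : Cv φ) (hψ : Cv ψ) {q : H} (hq : ‖q‖ < 1)
    (h : Commute q (ev φ q)) : ev (φ * ψ) q = ev φ q * ev ψ q := by
  rw [ev_mul hφ hψ hq]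
  unfold ev evalC
  rw [← tsum_mul_left]
  change (∑' m, q ^ m * ev φ q * cf ψ m) = ∑' m, ev φ q * (_ ^ m * cf ψ m)
  congr 1
  funext m
  rw [(h.pow_left m).eq, mul_assoc]

theorem Cv.add {φ ψ : PowerSeries H} (hφ : Cv φ) (hψ : Cv ψ) : Cv (φ + ψ) := fun q hq =>
  ((hφ q hq).add (hψ q hq)).congr fun m => by simp [cf, mul_add]

theorem Cv.sub {φ ψ : PowerSeries H} (hφ : Cv φ) (hψ : Cv ψ) : Cv (φ - ψ) := fun q hq =>
  ((hφ q hq).sub (hψ q hq)).congr fun m => by simp [cf, mul_sub]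

theorem ev_add {φ ψ : PowerSeries H} (hφ : Cv φ) (hψ : Cv ψ) {q : H} (hq : ‖q‖ < 1) :
    ev (φ + ψ) q = ev φ q + ev ψ q := by
  unfold ev evalC
  rw [← (hφ q hq).tsum_add (hψ q hq)]
  congr 1; funext m; simp [cf, mul_add]

theorem ev_sub {φ ψ : PowerSeries H} (hφ : Cv φ) (hψ : Cv ψ) {q : H} (hq : ‖q‖ < 1) :
    ev (φ - ψ) q = ev φ q - ev ψ q := by
  unfold ev evalC
  rw [← (hφ q hq).tsum_sub (hψ q hq)]
  congr 1; funext m; simp [cf, mul_sub]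

theorem cf_C (c : H) (m : ℕ) (hm : m ≠ 0) : cf (PowerSeries.C c) m = 0 := by
  simp [cf, PowerSeries.coeff_C, hm]

theorem Cv_C (c : H) : Cv (PowerSeries.C c) := fun q _ =>
  summable_of_ne_finset_zero (s := {0}) fun m hm => by
    rw [cf_C c m (by simpa using hm), mul_zero]

theorem ev_C (c q : H) : ev (PowerSeries.C c) q = c := by
  rw [ev, evalC_const (cf_C c)]; simp [cf]

theorem Cv_one : Cv 1 := by simpa using Cv_C 1
theorem ev_one (q : H) : ev 1 q = 1 := by simpa using ev_C 1 q

theorem Cv_X : Cv PowerSeries.X := fun q _ =>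
  summable_of_ne_finset_zero (s := {1}) fun m hm => by
    have : m ≠ 1 := by simpa using hm
    simp [cf, PowerSeries.coeff_X, this]

theorem ev_X (q : H) : ev PowerSeries.X q = q := by
  unfold ev evalC
  rw [tsum_eq_single 1 (fun m hm => by simp [cf, PowerSeries.coeff_X, hm])]
  simp [cf]

theorem ev_mul_C {φ : PowerSeries H} (c q : H) : ev (φ * PowerSeries.C c) q = ev φ q * c := by
  unfold ev evalC
  rw [← tsum_mul_right]
  congr 1; funext m; simp [cf, mul_assoc]

theorem Bd.mul {φ ψ : PowerSeries H} {c d : ℝ} (hφ : Bd (cf φ) c) (hψ : Bd (cf ψ) d)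
    (hc : 0 ≤ c) (hd : 0 ≤ d) : Bd (cf (φ * ψ)) (c * d) := by
  refine ⟨Cv.mul hφ.1 hψ.1, fun q hq => ?_⟩
  change ‖ev (φ * ψ) q‖ ≤ c * d
  by_cases h : ev φ q = 0
  · rw [ev_mul_zero hφ.1 hψ.1 hq h, norm_zero]; positivity
  · rw [ev_mul_ne hφ.1 hψ.1 hq h, norm_mul]
    refine mul_le_mul (hφ.2 q hq) (hψ.2 _ ?_) (norm_nonneg _) hc
    have := norm_rot (inv_ne_zero h) q
    rw [inv_inv] at this
    rwa [this]

theorem Bd_one : Bd (cf 1) 1 := ⟨Cv_one, fun q _ => by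
  change ‖ev 1 q‖ ≤ 1
  rw [ev_one, norm_one]⟩

theorem Bd.pow {φ : PowerSeries H} {c : ℝ} (hφ : Bd (cf φ) c) (hc : 0 ≤ c) (n : ℕ) :
    Bd (cf (φ ^ n)) (c ^ n) := by
  induction n with
  | zero => simpa using Bd_one
  | succ n ih => rw [pow_succ, pow_succ]; exact ih.mul hφ (by positivity) hc

theorem exists_inv {A : PowerSeries H} {c : ℝ} (hA : Bd (cf A) c) (h0 : 0 ≤ c) (hc : c < 1) :
    ∃ h : PowerSeries H, h * (1 - A) = 1 ∧ (1 - A) * h = 1 ∧ Cv h := by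
  have hA0 : ‖PowerSeries.constantCoeff A‖ ≤ c := by
    have := hA.coeff_le 0
    simpa [cf] using this
  have hu : PowerSeries.constantCoeff (1 - A) ≠ 0 := by
    intro h
    rw [map_sub, map_one, sub_eq_zero] at h
    rw [← h, norm_one] at hA0
    linarith
  set h := PowerSeries.invOfUnit (1 - A) (Units.mk0 _ hu) with hh
  have e1 : (1 - A) * h = 1 := PowerSeries.mul_invOfUnit _ _ rfl
  have e2 : h * (1 - A) = 1 := PowerSeries.invOfUnit_mul _ _ rfl
  refine ⟨h, e2, e1, summableOn_of_bdd (C := (1 - c)⁻¹) fun m => ?_⟩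
  have key : ∀ N : ℕ, ‖cf h m‖ ≤ (1 - c)⁻¹ +
      (∑ p ∈ Finset.HasAntidiagonal.antidiagonal m, ‖cf h p.1‖) * c ^ N := by
    intro N
    have e3 : h = ∑ i ∈ Finset.range N, A ^ i + h * A ^ N := by
      have := mul_neg_geom_sum A N
      have h2 : h * ((1 - A) * ∑ i ∈ Finset.range N, A ^ i) = h * (1 - A ^ N) := by rw [this]
      rw [← mul_assoc, e2, one_mul] at h2
      rw [h2]; noncomm_ring
    have e4 : cf h m = ∑ i ∈ Finset.range N, cf (A ^ i) m + cf (h * A ^ N) m := by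
      conv_lhs => rw [e3]
      simp [cf]
    rw [e4]
    refine (norm_add_le _ _).trans (add_le_add ?_ ?_)
    · refine (norm_sum_le _ _).trans ?_
      refine (Finset.sum_le_sum fun i _ => (hA.pow h0 i).coeff_le m).trans ?_
      rw [← tsum_geometric_of_lt_one h0 hc]
      exact (summable_geometric_of_lt_one h0 hc).sum_le_tsum _ (fun i _ => by positivity)
    · rw [cf, PowerSeries.coeff_mul, Finset.sum_mul]
      refine (norm_sum_le _ _).trans (Finset.sum_le_sum fun p _ => ?_)
      rw [norm_mul]
      exact mul_le_mul_of_nonneg_left ((hA.pow h0 N).coeff_le _) (norm_nonneg _)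
  have hlim := ((tendsto_pow_atTop_nhds_zero_of_lt_one h0 hc).const_mul
    (∑ p ∈ Finset.HasAntidiagonal.antidiagonal m, ‖cf h p.1‖)).const_add (1 - c)⁻¹
  rw [mul_zero, add_zero] at hlim
  exact ge_of_tendsto' hlim key

theorem quat_id (f w : H) : ‖1 - f * star w‖ ^ 2 - ‖f - w‖ ^ 2 = (1 - ‖f‖ ^ 2) * (1 - ‖w‖ ^ 2) := by
  simp only [sq ‖_‖, ← Quaternion.normSq_eq_norm_mul_self]
  simp only [Quaternion.normSq_def']
  have o0 : (1 : H).re = 1 := rfl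
  have o1 : (1 : H).imI = 0 := rfl
  have o2 : (1 : H).imJ = 0 := rfl
  have o3 : (1 : H).imK = 0 := rfl
  simp [o0, o1, o2, o3]
  ring

theorem quat_le {f w : H} (hf : ‖f‖ ≤ 1) (hw : ‖w‖ ≤ 1) : ‖f - w‖ ≤ ‖1 - f * star w‖ := by
  have h := quat_id f w
  have h1 : 0 ≤ 1 - ‖f‖ ^ 2 := by nlinarith [norm_nonneg f]
  have h2 : 0 ≤ 1 - ‖w‖ ^ 2 := by nlinarith [norm_nonneg w]
  refine (pow_le_pow_iff_left₀ (norm_nonneg _) (norm_nonneg _) two_ne_zero).1 ?_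
  nlinarith [mul_nonneg h1 h2]

theorem Bd.cv {φ : PowerSeries H} {c : ℝ} (h : Bd (cf φ) c) : Cv φ := h.1

theorem exists_mob {φ : PowerSeries H} (hφ : Bd (cf φ) 1) {w : H} (hw : ‖w‖ < 1) :
    ∃ k : PowerSeries H, Bd (cf k) 1 ∧
      (1 - φ * PowerSeries.C (star w)) * k = φ - PowerSeries.C w := by
  have hA : Bd (cf (φ * PowerSeries.C (star w))) ‖w‖ := by
    refine ⟨hφ.cv.mul (Cv_C _), fun q hq => ?_⟩
    change ‖ev _ q‖ ≤ _
    rw [ev_mul_C, norm_mul, norm_star]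
    have := hφ.2 q hq
    exact mul_le_of_le_one_left (norm_nonneg _) this
  obtain ⟨h, h1, h2, hcv⟩ := exists_inv hA (norm_nonneg _) hw
  have cA : Cv (1 - φ * PowerSeries.C (star w)) := Cv_one.sub hA.1
  have cB : Cv (φ - PowerSeries.C w) := hφ.cv.sub (Cv_C _)
  refine ⟨h * (φ - PowerSeries.C w), ⟨hcv.mul cB, fun q hq => ?_⟩, by rw [← mul_assoc, h2, one_mul]⟩
  change ‖ev _ q‖ ≤ 1
  have hne : ev h q ≠ 0 := by
    intro h0
    have := ev_mul_zero hcv cA hq h0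
    rw [h1, ev_one] at this
    exact one_ne_zero this
  set p := (ev h q)⁻¹ * q * ev h q with hp
  have hpn : ‖p‖ < 1 := by
    have := norm_rot (inv_ne_zero hne) q
    rw [inv_inv] at this
    rwa [hp, this]
  have e1 := ev_mul_ne hcv cA hq hne
  rw [h1, ev_one, ev_sub Cv_one hA.1 hpn, ev_one, ev_mul_C] at e1
  have e2 := ev_mul_ne hcv cB hq hne
  rw [ev_sub hφ.cv (Cv_C _) hpn, ev_C] at e2
  rw [e2, norm_mul]
  have e3 : 1 = ‖ev h q‖ * ‖1 - ev φ p * star w‖ := by rw [← norm_mul, ← e1, norm_one]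
  rw [e3]
  exact mul_le_mul_of_nonneg_left (quat_le (hφ.2 p hpn) hw.le) (norm_nonneg _)

theorem C_comm (r : ℝ) (φ : PowerSeries H) :
    PowerSeries.C (r : H) * φ = φ * PowerSeries.C (r : H) := by
  ext1 m
  rw [PowerSeries.coeff_C_mul, PowerSeries.coeff_mul_C, Quaternion.coe_commutes]

/-- `X - r` -/
def Lr (r : ℝ) : PowerSeries H := PowerSeries.X - PowerSeries.C (r : H)
/-- `1 - r X` -/
def Dr (r : ℝ) : PowerSeries H := 1 - PowerSeries.X * PowerSeries.C (r : H)

theorem Lr_comm (r : ℝ) (φ : PowerSeries H) : Lr r * φ = φ * Lr r := by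
  rw [Lr, sub_mul, mul_sub, C_comm, PowerSeries.X_mul]

theorem Dr_comm (r : ℝ) (φ : PowerSeries H) : Dr r * φ = φ * Dr r := by
  rw [Dr, sub_mul, mul_sub, mul_assoc, C_comm, ← mul_assoc, PowerSeries.X_mul, one_mul, mul_one,
    ← mul_assoc, mul_assoc, PowerSeries.X_mul]

theorem Lr_cv (r : ℝ) : Cv (Lr r) := Cv_X.sub (Cv_C _)
theorem Dr_cv (r : ℝ) : Cv (Dr r) := Cv_one.sub (Cv_X.mul (Cv_C _))

theorem ev_Lr (r : ℝ) {q : H} (hq : ‖q‖ < 1) : ev (Lr r) q = q - r := by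
  rw [Lr, ev_sub Cv_X (Cv_C _) hq, ev_X, ev_C]

theorem ev_Dr (r : ℝ) {q : H} (hq : ‖q‖ < 1) : ev (Dr r) q = 1 - q * r := by
  rw [Dr, ev_sub Cv_one (Cv_X.mul (Cv_C _)) hq, ev_one, ev_mul_C, ev_X]

theorem ev_Lr_mul (r : ℝ) {φ : PowerSeries H} (hφ : Cv φ) {q : H} (hq : ‖q‖ < 1) :
    ev (Lr r * φ) q = (q - r) * ev φ q := by
  rw [ev_mul_comm (Lr_cv r) hφ hq, ev_Lr r hq]
  rw [ev_Lr r hq]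
  exact (Commute.refl q).sub_right (Quaternion.coe_commute r q).symm

theorem ev_Dr_mul (r : ℝ) {φ : PowerSeries H} (hφ : Cv φ) {q : H} (hq : ‖q‖ < 1) :
    ev (Dr r * φ) q = (1 - q * r) * ev φ q := by
  rw [ev_mul_comm (Dr_cv r) hφ hq, ev_Dr r hq]
  rw [ev_Dr r hq]
  exact (Commute.one_right q).sub_right
    ((Commute.refl q).mul_right (Quaternion.coe_commute r q).symm)

theorem norm_real_lt {r : ℝ} (hr : -1 < r ∧ r < 1) : ‖(r : H)‖ < 1 := by
  rw [Quaternion.norm_coe, Real.norm_eq_abs, abs_lt]; exact hr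

theorem one_sub_ne {q : H} (h : ‖q‖ < 1) : 1 - q ≠ 0 := by
  intro h'
  rw [sub_eq_zero] at h'
  rw [← h', norm_one] at h
  exact lt_irrefl _ h

/-- existence of `k = M_r g` -/
theorem exists_k {r : ℝ} (hr : -1 < r ∧ r < 1) {g : PowerSeries H} (hg : Bd (cf g) 1) :
    ∃ k : PowerSeries H, Bd (cf k) 1 ∧ Dr r * k = Lr r * g := by
  have hA : Bd (cf (PowerSeries.X * PowerSeries.C (r : H))) ‖(r : H)‖ := by
    refine ⟨Cv_X.mul (Cv_C _), fun q hq => ?_⟩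
    change ‖ev _ q‖ ≤ _
    rw [ev_mul_C, ev_X, norm_mul]
    exact mul_le_of_le_one_left (norm_nonneg _) hq.le
  obtain ⟨h, -, h2, hcv⟩ := exists_inv hA (norm_nonneg _) (norm_real_lt hr)
  have ck : Cv (h * (Lr r * g)) := hcv.mul ((Lr_cv r).mul hg.1)
  have e : Dr r * (h * (Lr r * g)) = Lr r * g := by
    rw [← mul_assoc, Dr, h2, one_mul]
  refine ⟨h * (Lr r * g), ⟨ck, fun q hq => ?_⟩, e⟩
  change ‖ev _ q‖ ≤ 1
  have e1 := congrArg (fun φ => ‖ev φ q‖) e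
  simp only [ev_Dr_mul r ck hq, ev_Lr_mul r hg.1 hq, norm_mul] at e1
  have hle := quat_le hq.le (norm_real_lt hr).le
  rw [Quaternion.star_coe] at hle
  have hg1 : ‖ev g q‖ ≤ 1 := hg.2 q hq
  have hpos : 0 < ‖1 - q * (r : H)‖ := norm_pos_iff.2 (one_sub_ne (by
    rw [norm_mul]; nlinarith [norm_nonneg q, norm_real_lt hr, norm_nonneg (r : H)]))
  refine le_of_mul_le_mul_left ?_ hpos
  rw [e1, mul_one]
  exact (mul_le_of_le_one_right (norm_nonneg _) hg1).trans hle

theorem schwarz {r : ℝ} (hr : -1 < r ∧ r < 1) {k : PowerSeries H} (hk : Bd (cf k) 1)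
    (h0 : ev k (r : H) = 0) : ∃ g : PowerSeries H, Bd (cf g) 1 ∧ Lr r * g = Dr r * k := by
  have hrn := norm_real_lt hr
  have hsum : ∀ m, Summable fun j => (r : H) ^ j * cf k (j + m) := fun m =>
    summableOn_of_bdd (C := 1) (fun j => hk.coeff_le (j + m)) _ hrn
  set d : PowerSeries H := PowerSeries.mk fun m => ∑' j, (r : H) ^ j * cf k (j + (m + 1)) with hd
  have hdc : ∀ m, cf d m = ∑' j, (r : H) ^ j * cf k (j + (m + 1)) := fun m => by
    simp [cf, hd]
  have hrec : ∀ m, ∑' j, (r : H) ^ j * cf k (j + m) = cf k m + r * cf d m := by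
    intro m
    rw [(hsum m).tsum_eq_zero_add, hdc, ← tsum_mul_left]
    congr 1
    · simp
    · congr 1; funext j
      rw [pow_succ', mul_assoc, add_right_comm, add_assoc]
  have hdL : Lr r * d = k := by
    ext1 m
    rw [Lr, sub_mul, map_sub, PowerSeries.coeff_C_mul]
    change _ - (r : H) * cf d m = cf k m
    rw [sub_eq_iff_eq_add, ← hrec m]
    cases m with
    | zero =>
      rw [PowerSeries.coeff_zero_X_mul]
      exact h0.symm
    | succ m =>
      rw [PowerSeries.coeff_succ_X_mul]
      exact hdc m
  have hdcv : Cv d := by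
    refine summableOn_of_bdd (C := (1 - ‖(r : H)‖)⁻¹) fun m => ?_
    rw [hdc, ← tsum_geometric_of_lt_one (norm_nonneg _) hrn]
    refine tsum_of_norm_bounded (summable_geometric_of_lt_one (norm_nonneg _) hrn).hasSum fun j => ?_
    rw [norm_mul, norm_pow]
    exact mul_le_of_le_one_right (by positivity) (hk.coeff_le _)
  have hgcv : Cv (Dr r * d) := (Dr_cv r).mul hdcv
  have hLg : Lr r * (Dr r * d) = Dr r * k := by
    rw [← mul_assoc, Lr_comm, mul_assoc, hdL]
  refine ⟨Dr r * d, ⟨hgcv, fun q hq => ?_⟩, hLg⟩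
  -- the bound
  set B : ℝ := (1 - ‖(r : H)‖ ^ 2) / (1 - ‖(r : H)‖) ^ 2 with hB
  have key : ∀ t : ℝ, ‖q‖ < t → t < 1 →
      ‖evalC (cf (Dr r * d)) q‖ ^ 2 * (1 - (1 - t ^ 2) * B) ≤ 1 := by
    intro t hqt ht
    have ht0 : 0 ≤ t := (norm_nonneg q).trans hqt.le
    by_cases hpos : 0 < 1 - (1 - t ^ 2) * B
    · have hs : ∀ p : H, ‖p‖ = t → ‖evalC (cf (Dr r * d)) p‖ ≤ (Real.sqrt (1 - (1 - t ^ 2) * B))⁻¹ := by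
        intro p hp
        have hp1 : ‖p‖ < 1 := by rw [hp]; exact ht
        have e1 := congrArg (fun φ => ‖ev φ p‖) hLg
        simp only [ev_Dr_mul r hk.1 hp1, ev_Lr_mul r hgcv hp1, norm_mul] at e1
        have hkp : ‖ev k p‖ ≤ 1 := hk.2 p hp1
        have hid := quat_id p (r : H)
        rw [Quaternion.star_coe, hp] at hid
        have hlow : 1 - ‖(r : H)‖ ≤ ‖1 - p * (r : H)‖ := by
          have h1 := norm_sub_norm_le (1 : H) (p * (r : H))
          rw [norm_one, norm_mul] at h1
          nlinarith [norm_nonneg (r : H)]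
        set N := ‖1 - p * (r : H)‖
        set M := ‖p - (r : H)‖
        set G := ‖ev (Dr r * d) p‖ with hG
        have hr0 : 0 < 1 - ‖(r : H)‖ := by linarith
        have hN : 0 < N := hr0.trans_le hlow
        have hM : N ^ 2 * (1 - (1 - t ^ 2) * B) ≤ M ^ 2 := by
          have hBN : 1 - ‖(r : H)‖ ^ 2 ≤ B * N ^ 2 := by
            rw [hB, div_mul_eq_mul_div, le_div_iff₀ (by positivity)]
            refine mul_le_mul_of_nonneg_left ?_ (by nlinarith [norm_nonneg (r : H)])
            exact pow_le_pow_left₀ hr0.le hlow 2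
          have ht2 : 0 ≤ 1 - t ^ 2 := by nlinarith
          nlinarith [mul_le_mul_of_nonneg_left hBN ht2]
        have hGN : M * G ≤ N := by
          rw [e1]; exact mul_le_of_le_one_right hN.le hkp
        have h2 : G ^ 2 * (1 - (1 - t ^ 2) * B) ≤ 1 := by
          have h3 : (M * G) ^ 2 ≤ N ^ 2 := pow_le_pow_left₀ (by positivity) hGN 2
          have h4 : G ^ 2 * (N ^ 2 * (1 - (1 - t ^ 2) * B)) ≤ G ^ 2 * M ^ 2 :=
            mul_le_mul_of_nonneg_left hM (by positivity)
          have h5 : N ^ 2 * (G ^ 2 * (1 - (1 - t ^ 2) * B)) ≤ N ^ 2 * 1 := by nlinarith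
          exact le_of_mul_le_mul_left h5 (by positivity)
        change G ≤ _
        rw [← Real.sqrt_inv]
        apply Real.le_sqrt_of_sq_le
        rwa [← one_div, le_div_iff₀ hpos]
      have h1 := sphere_bound hgcv ht hs q hqt.le
      rw [← Real.sqrt_inv] at h1
      have h2 := pow_le_pow_left₀ (norm_nonneg _) h1 2
      rw [Real.sq_sqrt (by positivity), ← one_div, le_div_iff₀ hpos] at h2
      exact h2
    · exact (mul_nonpos_of_nonneg_of_nonpos (by positivity) (not_lt.1 hpos)).trans zero_le_one
  have hlim : Filter.Tendsto
      (fun t : ℝ => ‖evalC (cf (Dr r * d)) q‖ ^ 2 * (1 - (1 - t ^ 2) * B)) (nhdsWithin 1 (Set.Iio 1))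
      (nhds (‖evalC (cf (Dr r * d)) q‖ ^ 2 * (1 - (1 - 1 ^ 2) * B))) :=
    (Continuous.tendsto (by fun_prop) 1).mono_left nhdsWithin_le_nhds
  have h1 : ‖evalC (cf (Dr r * d)) q‖ ^ 2 * (1 - (1 - 1 ^ 2) * B) ≤ 1 := by
    refine le_of_tendsto hlim ?_
    filter_upwards [Ioo_mem_nhdsLT hq] with t ht
    exact key t ht.1 ht.2
  refine (sq_le_one_iff₀ (norm_nonneg _)).1 ?_
  simpa using h1

/-- one step of the Schur algorithm, as a relation -/
def Rel (w : H) (r : ℝ) (a g : PowerSeries H) : Prop :=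
  (1 - a * PowerSeries.C (star w)) * (Lr r * g) = Dr r * (a - PowerSeries.C w)

theorem real_comm (r : ℝ) (q : H) : Commute (r : H) q := Quaternion.coe_commute r q

theorem ev_mob {a k : PowerSeries H} {w : H} (ha : Cv a) (hk : Cv k) {x : ℝ} (hx : ‖(x : H)‖ < 1) :
    ev ((1 - a * PowerSeries.C (star w)) * k) (x : H) = (1 - ev a x * star w) * ev k x := by
  have hc : Cv (1 - a * PowerSeries.C (star w)) := Cv_one.sub (ha.mul (Cv_C _))
  rw [ev_mul_comm hc hk hx (real_comm _ _), ev_sub Cv_one (ha.mul (Cv_C _)) hx, ev_one, ev_mul_C]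

theorem norm_mul_star_lt {a w : H} (ha : ‖a‖ ≤ 1) (hw : ‖w‖ < 1) : ‖a * star w‖ < 1 := by
  rw [norm_mul, norm_star]
  exact (mul_le_of_le_one_left (norm_nonneg _) ha).trans_lt hw

theorem step_fwd {r : ℝ} (hr : -1 < r ∧ r < 1) {w : H} (hw : ‖w‖ < 1) {a : PowerSeries H}
    (ha : Bd (cf a) 1) (haw : ev a (r : H) = w) : ∃ g, Bd (cf g) 1 ∧ Rel w r a g := by
  obtain ⟨k, hk, e⟩ := exists_mob ha hw
  have hx := norm_real_lt hr
  have h0 : ev k (r : H) = 0 := by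
    have := ev_mob (w := w) ha.1 hk.1 hx
    rw [e, ev_sub ha.1 (Cv_C _) hx, ev_C, haw, sub_self] at this
    exact (mul_eq_zero.1 this.symm).resolve_left (one_sub_ne (norm_mul_star_lt hw.le hw))
  obtain ⟨g, hg, e2⟩ := schwarz hr hk h0
  refine ⟨g, hg, ?_⟩
  rw [Rel, e2, ← mul_assoc, ← Dr_comm, mul_assoc, e]

theorem star_mul_C (w : H) : (PowerSeries.C w : PowerSeries H) * PowerSeries.C (star w) =
    PowerSeries.C ((Quaternion.normSq w : ℝ) : H) := by
  rw [← map_mul, Quaternion.self_mul_star]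

theorem star_mul_C' (w : H) : (PowerSeries.C (star w) : PowerSeries H) * PowerSeries.C w =
    PowerSeries.C ((Quaternion.normSq w : ℝ) : H) := by
  rw [← map_mul, Quaternion.star_mul_self]

theorem step_bwd {r : ℝ} (hr : -1 < r ∧ r < 1) {w : H} (hw : ‖w‖ < 1) {g : PowerSeries H}
    (hg : Bd (cf g) 1) : ∃ a, Bd (cf a) 1 ∧ ev a (r : H) = w ∧ Rel w r a g := by
  obtain ⟨k, hk, e⟩ := exists_k hr hg
  obtain ⟨a, ha, e2⟩ := exists_mob hk (w := -w) (by rwa [norm_neg])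
  have e3 : (1 - a * PowerSeries.C (star w)) * k = a - PowerSeries.C w := by
    have hu : (1 - k * PowerSeries.C (star (-w)) : PowerSeries H) ≠ 0 := by
      intro h
      have h2 := congrArg (fun φ => PowerSeries.constantCoeff φ) h
      simp only [map_sub, map_one, map_mul, map_zero, PowerSeries.constantCoeff_C] at h2
      have hk0 : ‖PowerSeries.constantCoeff k‖ ≤ 1 := by
        have := hk.coeff_le 0
        simpa [cf] using this
      exact one_sub_ne (norm_mul_star_lt hk0 (by rwa [norm_neg])) h2
    refine mul_left_cancel₀ hu ?_
    rw [← mul_assoc, mul_sub, mul_sub, ← mul_assoc, e2]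
    have h1 := star_mul_C w
    have h2 := star_mul_C' w
    have h3 := C_comm (Quaternion.normSq w) k
    simp only [star_neg, map_neg, mul_neg, sub_neg_eq_add, mul_one, add_mul, one_mul, sub_mul, mul_assoc, h1, h2,
      h3, neg_mul]
    simp only [← mul_assoc, h1, h3]
    abel
  have hx := norm_real_lt hr
  have k0 : ev k (r : H) = 0 := by
    have := congrArg (fun φ => ev φ (r : H)) e
    simp only [ev_Dr_mul r hk.1 hx, ev_Lr_mul r hg.1 hx, sub_self, zero_mul] at this
    refine (mul_eq_zero.1 this).resolve_left (one_sub_ne ?_)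
    have := norm_mul_star_lt hx.le hx
    rwa [Quaternion.star_coe] at this
  refine ⟨a, ha, ?_, ?_⟩
  · have := ev_mob (w := w) ha.1 hk.1 hx
    rw [e3, ev_sub ha.1 (Cv_C _) hx, ev_C, k0, mul_zero, sub_eq_zero] at this
    exact this
  · rw [Rel, ← e, ← mul_assoc, ← Dr_comm, mul_assoc, e3]

theorem Bd.c0 {k : PowerSeries H} (hk : Bd (cf k) 1) : ‖PowerSeries.constantCoeff k‖ ≤ 1 := by
  have := hk.coeff_le 0
  simpa [cf] using this

theorem rel_inj_right {r : ℝ} {w : H} (hw : ‖w‖ < 1) {a g g' : PowerSeries H} (ha : Bd (cf a) 1)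
    (h : Rel w r a g) (h' : Rel w r a g') : g = g' := by
  have hu : (1 - a * PowerSeries.C (star w) : PowerSeries H) ≠ 0 := by
    intro h
    have h2 := congrArg (fun φ => PowerSeries.constantCoeff φ) h
    simp only [map_sub, map_one, map_mul, map_zero, PowerSeries.constantCoeff_C] at h2
    exact one_sub_ne (norm_mul_star_lt ha.c0 hw) h2
  have hL : Lr r ≠ 0 := by
    intro h
    have := congrArg (PowerSeries.coeff 1) h
    simp [Lr, PowerSeries.coeff_C] at this
  exact mul_left_cancel₀ hL (mul_left_cancel₀ hu (h.trans h'.symm))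

theorem rel_inj_left {r : ℝ} (hr : -1 < r ∧ r < 1) {w : H} (hw : ‖w‖ < 1) {a a' g : PowerSeries H}
    (hg : Bd (cf g) 1) (h : Rel w r a g) (h' : Rel w r a' g) : a = a' := by
  have e : (a - a') * (Dr r + PowerSeries.C (star w) * (Lr r * g)) = 0 := by
    unfold Rel at h h'
    rw [Dr_comm] at h h'
    have h1 : (a - a') * (Dr r + PowerSeries.C (star w) * (Lr r * g)) =
      ((a - PowerSeries.C w) * Dr r - (1 - a * PowerSeries.C (star w)) * (Lr r * g)) -
      ((a' - PowerSeries.C w) * Dr r - (1 - a' * PowerSeries.C (star w)) * (Lr r * g)) := by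
      noncomm_ring
    rw [h1, h, h', sub_self, sub_self, sub_self]
  refine sub_eq_zero.1 ((mul_eq_zero.1 e).resolve_right fun h0 => ?_)
  have h2 := congrArg (fun φ => PowerSeries.constantCoeff φ) h0
  simp only [Dr, Lr, map_sub, map_add, map_one, map_mul, map_zero, PowerSeries.constantCoeff_C,
    PowerSeries.constantCoeff_X, zero_mul, sub_zero, zero_sub] at h2
  rw [neg_mul, mul_neg, ← sub_eq_add_neg] at h2
  refine one_sub_ne ?_ h2
  rw [norm_mul, norm_mul, norm_star]
  have := norm_real_lt hr
  have h3 := hg.c0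
  have h4 : ‖(r : H)‖ * ‖PowerSeries.constantCoeff g‖ ≤ 1 :=
    mul_le_one₀ this.le (norm_nonneg _) h3
  exact (mul_le_of_le_one_right (norm_nonneg _) h4).trans_lt hw

theorem rel_ev {r : ℝ} {w : H} {a g : PowerSeries H} (ha : Cv a) (hg : Cv g) (h : Rel w r a g)
    {x : ℝ} (hx : -1 < x ∧ x < 1) :
    (1 - ev a x * star w) * ((x - r : ℝ) • ev g x) = (1 - x * r : ℝ) • (ev a x - w) := by
  have hx' := norm_real_lt hx
  have := congrArg (fun φ => ev φ (x : H)) h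
  simp only [ev_mob ha ((Lr_cv r).mul hg) hx', ev_Lr_mul r hg hx',
    ev_Dr_mul r (ha.sub (Cv_C w)) hx', ev_sub ha (Cv_C w) hx', ev_C] at this
  rw [← Quaternion.coe_mul_eq_smul, ← Quaternion.coe_mul_eq_smul]
  push_cast
  exact this

/-- the Nevanlinna step -/
theorem npQ_rel {x r : ℝ} (hx : -1 < x ∧ x < 1) (hr : -1 < r ∧ r < 1) (hne : x ≠ r) {S w : H}
    (hS : ‖S‖ ≤ 1) (hw : ‖w‖ < 1) (G : H) :
    G = ((1 - (x : H) * (r : H))⁻¹ * ((x : H) - (r : H)))⁻¹ * ((1 - S * star w)⁻¹ * (S - w)) ↔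
    (1 - S * star w) * ((x - r : ℝ) • G) = (1 - x * r : ℝ) • (S - w) := by
  have h1 : x - r ≠ 0 := sub_ne_zero.2 hne
  have hb : 1 - S * star w ≠ 0 := one_sub_ne (norm_mul_star_lt hS hw)
  have e : ((1 - (x : H) * (r : H))⁻¹ * ((x : H) - (r : H)))⁻¹ = (((1 - x * r) / (x - r) : ℝ) : H) := by
    rw [mul_inv_rev, inv_inv, Quaternion.coe_div, div_eq_mul_inv]
    push_cast
    have := (real_comm (x - r)⁻¹ (1 - (x : H) * (r : H))).eq
    push_cast at this
    exact this
  rw [e, Quaternion.coe_mul_eq_smul]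
  constructor
  · rintro rfl
    rw [smul_smul, mul_div_cancel₀ _ h1, mul_smul_comm, mul_inv_cancel_left₀ hb]
  · intro h
    have h2 : (x - r : ℝ) • G = (1 - x * r : ℝ) • ((1 - S * star w)⁻¹ * (S - w)) := by
      rw [← mul_smul_comm, eq_inv_mul_iff_mul_eq₀ hb]
      exact h
    rw [div_eq_inv_mul, mul_smul, ← h2, smul_smul, inv_mul_cancel₀ h1, one_smul]

theorem rel_unique {x r : ℝ} (hx : -1 < x ∧ x < 1) (hr : -1 < r ∧ r < 1) {S S' w G : H}
    (hw : ‖w‖ < 1) (hG : ‖G‖ ≤ 1)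
    (h : (1 - S * star w) * ((x - r : ℝ) • G) = (1 - x * r : ℝ) • (S - w))
    (h' : (1 - S' * star w) * ((x - r : ℝ) • G) = (1 - x * r : ℝ) • (S' - w)) : S = S' := by
  have hd : 0 < 1 - x * r := by nlinarith
  rw [mul_smul_comm] at h h'
  have e : (S - S') * ((1 - x * r : ℝ) • (1 : H) + (x - r : ℝ) • (star w * G)) = 0 := by
    have : (S - S') * ((1 - x * r : ℝ) • (1 : H) + (x - r : ℝ) • (star w * G)) =
      ((1 - x * r : ℝ) • (S - w) - (x - r : ℝ) • ((1 - S * star w) * G)) -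
      ((1 - x * r : ℝ) • (S' - w) - (x - r : ℝ) • ((1 - S' * star w) * G)) := by
      simp only [mul_add, mul_smul_comm, sub_mul, mul_one, one_mul, smul_sub, mul_assoc]
      abel
    rw [this, h, h', sub_self, sub_self, sub_self]
  refine sub_eq_zero.1 ((mul_eq_zero.1 e).resolve_right fun h0 => ?_)
  have h2 := congrArg norm (eq_neg_of_add_eq_zero_left h0)
  rw [norm_neg, norm_smul, norm_smul, norm_one, norm_mul, norm_star, Real.norm_eq_abs,
    Real.norm_eq_abs, abs_of_pos hd, mul_one] at h2
  have h3 : |x - r| ≤ 1 - x * r := by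
    rw [abs_le]; constructor <;> nlinarith
  have h4 : ‖w‖ * ‖G‖ < 1 := (mul_le_of_le_one_right (norm_nonneg _) hG).trans_lt hw
  nlinarith [abs_nonneg (x - r), norm_nonneg w, norm_nonneg G, mul_nonneg (norm_nonneg w) (norm_nonneg G)]

theorem Bd.eq_C {φ : PowerSeries H} (h : Bd (cf φ) 1) {q : H} (hq : ‖q‖ < 1) (he : 1 ≤ ‖ev φ q‖) :
    φ = PowerSeries.C (ev φ q) := by
  have h1 : ‖evalC (cf φ) q‖ = 1 := le_antisymm (h.2 q hq) he
  have h2 := h.const hq h1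
  ext1 m
  by_cases hm : m = 0
  · subst hm
    rw [PowerSeries.coeff_C, if_pos rfl, ev, evalC_const h2]
    rfl
  · rw [PowerSeries.coeff_C, if_neg hm]
    exact h2 m hm

/-- solutions of the reduced problem in the closed class -/
def Sol (n : ℕ) (r : ℕ → ℝ) (s : ℕ → H) (κ : ℕ) : Set (PowerSeries H) :=
  {φ | Bd (cf φ) 1 ∧ ∀ ℓ, κ < ℓ → ℓ ≤ n → ev φ ((r ℓ : ℝ) : H) = npQ r s κ ℓ}

theorem cf_mk (a : ℕ → H) : cf (PowerSeries.mk a) = a := by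
  funext m; simp [cf]

theorem cf_inj : Function.Injective cf := fun φ ψ h => by
  ext1 m; exact congrFun h m

theorem sol_lt {n : ℕ} {r : ℕ → ℝ} {s : ℕ → H} {κ : ℕ}
    (hr : ∀ m, 1 ≤ m → m ≤ n → -1 < r m ∧ r m < 1)
    (hinf : (Sol n r s κ).Infinite) (ℓ : ℕ) (h1 : κ < ℓ) (h2 : ℓ ≤ n) : ‖npQ r s κ ℓ‖ < 1 := by
  by_contra hge
  refine hinf ((Set.finite_singleton (PowerSeries.C (npQ r s κ ℓ))).subset fun φ hφ => ?_)
  have e := hφ.2 ℓ h1 h2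
  have := hφ.1.eq_C (norm_real_lt (hr ℓ (by omega) h2)) (by rw [e]; exact not_lt.1 hge)
  rw [e] at this
  exact this

theorem sol_succ {n : ℕ} {r : ℕ → ℝ} {s : ℕ → H} {κ : ℕ}
    (hr : ∀ m, 1 ≤ m → m ≤ n → -1 < r m ∧ r m < 1)
    (hdist : ∀ m m', 1 ≤ m → m ≤ n → 1 ≤ m' → m' ≤ n → m ≠ m' → r m ≠ r m')
    (hκ : κ < n) (hw : ‖npQ r s κ (κ + 1)‖ < 1)
    (hinf : (Sol n r s κ).Infinite) : (Sol n r s (κ + 1)).Infinite := by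
  have hrκ := hr (κ + 1) (by omega) (by omega)
  have : ∀ a : PowerSeries H, ∃ g, a ∈ Sol n r s κ →
      (Bd (cf g) 1 ∧ Rel (npQ r s κ (κ + 1)) (r (κ + 1)) a g) := by
    intro a
    by_cases ha : a ∈ Sol n r s κ
    · obtain ⟨g, hg⟩ := step_fwd hrκ hw ha.1 (ha.2 (κ + 1) (by omega) (by omega))
      exact ⟨g, fun _ => hg⟩
    · exact ⟨0, fun h => absurd h ha⟩
  choose Φ hΦ using this
  refine Set.infinite_of_injOn_mapsTo (f := Φ) ?_ ?_ hinf
  · intro a ha a' ha' h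
    have h1 := hΦ a ha
    have h2 := hΦ a' ha'
    rw [← h] at h2
    exact rel_inj_left hrκ hw h1.1 h1.2 h2.2
  · intro a ha
    obtain ⟨hg, hR⟩ := hΦ a ha
    refine ⟨hg, fun ℓ h1 h2 => ?_⟩
    have hx := hr ℓ (by omega) h2
    have e := rel_ev ha.1.1 hg.1 hR hx
    have e2 := ha.2 ℓ (by omega) h2
    have h3 : ‖ev a ((r ℓ : ℝ) : H)‖ ≤ 1 := ha.1.2 _ (norm_real_lt hx)
    rw [e2] at e h3
    exact (npQ_rel hx hrκ (hdist _ _ (by omega) h2 (by omega) (by omega) (by omega)) h3 hw _).2 e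

theorem sol_pred {n : ℕ} {r : ℕ → ℝ} {s : ℕ → H} {κ : ℕ}
    (hr : ∀ m, 1 ≤ m → m ≤ n → -1 < r m ∧ r m < 1)
    (hdist : ∀ m m', 1 ≤ m → m ≤ n → 1 ≤ m' → m' ≤ n → m ≠ m' → r m ≠ r m')
    (hκ : κ < n) (hw : ∀ ℓ, κ < ℓ → ℓ ≤ n → ‖npQ r s κ ℓ‖ < 1)
    (hinf : (Sol n r s (κ + 1)).Infinite) : (Sol n r s κ).Infinite := by
  have hrκ := hr (κ + 1) (by omega) (by omega)
  have hw0 := hw (κ + 1) (by omega) (by omega)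
  have : ∀ g : PowerSeries H, ∃ a, g ∈ Sol n r s (κ + 1) →
      (Bd (cf a) 1 ∧ ev a ((r (κ + 1) : ℝ) : H) = npQ r s κ (κ + 1) ∧
        Rel (npQ r s κ (κ + 1)) (r (κ + 1)) a g) := by
    intro g
    by_cases hg : g ∈ Sol n r s (κ + 1)
    · obtain ⟨a, ha⟩ := step_bwd hrκ hw0 hg.1
      exact ⟨a, fun _ => ha⟩
    · exact ⟨0, fun h => absurd h hg⟩
  choose Φ hΦ using this
  refine Set.infinite_of_injOn_mapsTo (f := Φ) ?_ ?_ hinf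
  · intro g hg g' hg' h
    have h1 := hΦ g hg
    have h2 := hΦ g' hg'
    rw [← h] at h2
    exact rel_inj_right hw0 h1.1 h1.2.2 h2.2.2
  · intro g hg
    obtain ⟨ha, haw, hR⟩ := hΦ g hg
    refine ⟨ha, fun ℓ h1 h2 => ?_⟩
    by_cases hl : ℓ = κ + 1
    · rw [hl]; exact haw
    have hx := hr ℓ (by omega) h2
    have e := rel_ev ha.1 hg.1.1 hR hx
    have e2 := hg.2 ℓ (by omega) h2
    have e3 := (npQ_rel hx hrκ (hdist _ _ (by omega) h2 (by omega) (by omega) hl)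
      (hw ℓ h1 h2).le hw0 _).1 e2
    have h3 : ‖ev g ((r ℓ : ℝ) : H)‖ ≤ 1 := hg.1.2 _ (norm_real_lt hx)
    exact rel_unique hx hrκ hw0 h3 e e3

theorem sol_last (n : ℕ) (r : ℕ → ℝ) (s : ℕ → H) : (Sol n r s n).Infinite := by
  refine Set.infinite_of_injOn_mapsTo (f := fun t : ℝ => (PowerSeries.C (t : H) : PowerSeries H))
    (s := Set.Icc 0 1) ?_ ?_ (Set.Icc_infinite zero_lt_one)
  · intro t _ t' _ h
    exact Quaternion.coe_injective (PowerSeries.C_injective h)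
  · intro t ht
    refine ⟨⟨Cv_C _, fun q _ => ?_⟩, fun ℓ h1 h2 => by omega⟩
    change ‖ev _ q‖ ≤ 1
    rw [ev_C, Quaternion.norm_coe, Real.norm_of_nonneg ht.1]
    exact ht.2

theorem sol_zero {n : ℕ} (hn : 1 ≤ n) {r : ℕ → ℝ} {s : ℕ → H}
    (hr : ∀ m, 1 ≤ m → m ≤ n → -1 < r m ∧ r m < 1)
    (hs : ∀ m, 1 ≤ m → m ≤ n → ‖s m‖ < 1) :
    {a : ℕ → H | SelfMap a ∧ ∀ m, 1 ≤ m → m ≤ n → evalC a ((r m : ℝ) : H) = s m} =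
      cf '' Sol n r s 0 := by
  ext a
  constructor
  · rintro ⟨ha, hi⟩
    refine ⟨PowerSeries.mk a, ⟨?_, ?_⟩, cf_mk a⟩
    · rw [cf_mk]; exact ⟨ha.1, fun q hq => (ha.2 q hq).le⟩
    · intro ℓ h1 h2
      rw [ev, cf_mk]
      exact hi ℓ h1 h2
  · rintro ⟨φ, hφ, rfl⟩
    refine ⟨⟨hφ.1.1, fun q hq => ?_⟩, fun m h1 h2 => hφ.2 m h1 h2⟩
    by_contra hge
    have h1 := hφ.1.eq_C hq (not_lt.1 hge)
    have h2 := hφ.2 1 (by omega) hn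
    rw [h1, ev_C] at h2
    refine hge ?_
    change ‖ev φ q‖ < 1
    rw [h2]
    exact hs 1 le_rfl hn

theorem norm_npQ_succ (r : ℕ → ℝ) (s : ℕ → H) (κ ℓ : ℕ) : ‖npQ r s (κ + 1) ℓ‖ =
    (rho ((r (κ + 1) : ℝ) : H) ((r ℓ : ℝ) : H))⁻¹ * rho (npQ r s κ (κ + 1)) (npQ r s κ ℓ) := by
  rw [npQ, norm_mul, norm_inv, rho, rho, mobiusM, mobiusM, Quaternion.star_coe]

theorem rho_pos {x r : ℝ} (hx : -1 < x ∧ x < 1) (hr : -1 < r ∧ r < 1) (hne : x ≠ r) :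
    0 < rho (r : H) (x : H) := by
  rw [rho, mobiusM, norm_pos_iff]
  refine mul_ne_zero (inv_ne_zero (one_sub_ne (norm_mul_star_lt (norm_real_lt hx).le (norm_real_lt hr)))) ?_
  rw [sub_ne_zero]
  exact fun h => hne (Quaternion.coe_injective h)

/-- `n`-point Nevanlinna–Pick interpolation with real nodes: the problem has
infinitely many solutions iff all the quantities `Q_{κ−1}^κ, Q_{κ−1}^ℓ` lie in
`𝔹` and `ρ(Q_{κ−1}^κ, Q_{κ−1}^ℓ) < ρ(r_κ, r_ℓ)`. -/
theorem nevanlinnaPick_n_points (n : ℕ) (hn : 3 ≤ n) (r : ℕ → ℝ) (s : ℕ → H)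
    (hr : ∀ m, 1 ≤ m → m ≤ n → -1 < r m ∧ r m < 1)
    (hdist : ∀ m m', 1 ≤ m → m ≤ n → 1 ≤ m' → m' ≤ n → m ≠ m' → r m ≠ r m')
    (hs : ∀ m, 1 ≤ m → m ≤ n → ‖s m‖ < 1) :
    {a : ℕ → H | SelfMap a ∧ ∀ m, 1 ≤ m → m ≤ n → evalC a ((r m : ℝ) : H) = s m}.Infinite ↔
      ∀ κ ℓ, 1 ≤ κ → κ ≤ n - 1 → κ < ℓ → ℓ ≤ n →
        ‖npQ r s (κ - 1) κ‖ < 1 ∧ ‖npQ r s (κ - 1) ℓ‖ < 1 ∧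
          rho (npQ r s (κ - 1) κ) (npQ r s (κ - 1) ℓ) <
            rho ((r κ : ℝ) : H) ((r ℓ : ℝ) : H) := by
  rw [sol_zero (by omega) hr hs, Set.infinite_image_iff cf_inj.injOn]
  have hstep : ∀ κ ℓ, κ + 1 < ℓ → ℓ ≤ n → (‖npQ r s (κ + 1) ℓ‖ < 1 ↔
      rho (npQ r s κ (κ + 1)) (npQ r s κ ℓ) < rho ((r (κ + 1) : ℝ) : H) ((r ℓ : ℝ) : H)) := by
    intro κ ℓ h1 h2
    have hp := rho_pos (hr ℓ (by omega) h2) (hr (κ + 1) (by omega) (by omega))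
      (hdist _ _ (by omega) h2 (by omega) (by omega) (by omega))
    rw [norm_npQ_succ, inv_mul_lt_iff₀ hp, mul_one]
  constructor
  · intro hinf
    have hall : ∀ κ, κ ≤ n → (Sol n r s κ).Infinite := by
      intro κ
      induction κ with
      | zero => exact fun _ => hinf
      | succ κ ih =>
        intro h
        have := ih (by omega)
        exact sol_succ hr hdist (by omega) (sol_lt hr this _ (by omega) (by omega)) this
    intro κ ℓ h1 h2 h3 h4
    obtain ⟨κ, rfl⟩ : ∃ j, κ = j + 1 := ⟨κ - 1, by omega⟩
    simp only [Nat.add_sub_cancel]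
    have i1 := hall κ (by omega)
    exact ⟨sol_lt hr i1 _ (by omega) (by omega), sol_lt hr i1 _ (by omega) h4,
      (hstep κ ℓ h3 h4).1 (sol_lt hr (hall (κ + 1) (by omega)) _ h3 h4)⟩
  · intro hcond
    have hQ : ∀ κ ℓ, κ < ℓ → ℓ ≤ n → ‖npQ r s κ ℓ‖ < 1 := by
      intro κ ℓ h1 h2
      cases κ with
      | zero => exact hs ℓ h1 h2
      | succ κ => exact (hstep κ ℓ h1 h2).2 (hcond (κ + 1) ℓ (by omega) (by omega) h1 h2).2.2
    have hall : ∀ j, j ≤ n → (Sol n r s (n - j)).Infinite := by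
      intro j
      induction j with
      | zero => exact fun _ => sol_last n r s
      | succ j ih =>
        intro h
        have i1 := ih (by omega)
        rw [show n - j = (n - (j + 1)) + 1 by omega] at i1
        exact sol_pred hr hdist (by omega) (fun ℓ => hQ _ ℓ) i1
    have := hall n le_rfl
    rwa [Nat.sub_self] at this

end QPaper
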